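/- arXiv:2605.02768 — 2 statements merged into one kernel-verified Lean document; each statement's English description precedes it below -/
import Mathlib

section
/- For every even integer q ≥ 2, every real β, every integer n ≥ q, and every v ≥ 1 with v ≤ n: μ_{v,0} = μ_v; in particular, the quantity μ_{v,0} (defined using σ² = (q−1)!/n^{q−1}) does not depend on n. -/
open MeasureTheory Filter

noncomputable section

namespace SYK

attribute [local instance] Classical.propDecidable

/-- The chord crossing sign `K(x,y)`. -/
def K (x y : ℝ × ℝ) : ℝ :=
  if (x.1 < y.1 ∧ y.1 < x.2 ∧ x.2 < y.2) ∨ (y.1 < x.1 ∧ x.1 < y.2 ∧ y.2 < x.2) then -1 else 1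

lemma K_symm (x y : ℝ × ℝ) : K x y = K y x := if_congr or_comm rfl rfl

/-- The law of `(min U₁ U₂, max U₁ U₂)` for `U₁, U₂` i.i.d. uniform on `[0,1]`. -/
def nu : Measure (ℝ × ℝ) :=
  Measure.map (fun p : ℝ × ℝ => (min p.1 p.2, max p.1 p.2))
    (volume.restrict (Set.Icc (0 : ℝ) 1 ×ˢ Set.Icc (0 : ℝ) 1))

/-- Two vertices are related if some hyperedge of `E` contains both. -/
def edgeRel {N : ℕ} (E : Finset (Finset (Fin N))) (a b : Fin N) : Prop :=
  ∃ e ∈ E, a ∈ e ∧ b ∈ e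

/-- A hypergraph on the full vertex set `Fin N` is connected. -/
def HGConnected {N : ℕ} (E : Finset (Finset (Fin N))) : Prop :=
  ∀ a b : Fin N, Relation.ReflTransGen (edgeRel E) a b

/-- `E` is a `q`-uniform hypertree on the vertex set `Fin N`. -/
def IsHypertree (q N : ℕ) (E : Finset (Finset (Fin N))) : Prop :=
  (∀ e ∈ E, e.card = q) ∧ HGConnected E ∧ (q - 1) * E.card = N - 1

/-- The set `𝒯_N` of `q`-uniform hypertrees on `{1,…,N}`. -/
def trees (q N : ℕ) : Finset (Finset (Finset (Fin N))) :=
  Finset.univ.filter (IsHypertree q N)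

/-- Sign contributed by an unordered pair of hyperedges with chords given by `X`. -/
def pairSign {N : ℕ} (X : Finset (Fin N) → ℝ × ℝ) : Sym2 (Finset (Fin N)) → ℝ :=
  Sym2.lift ⟨fun e₁ e₂ => if Odd (e₁ ∩ e₂).card then K (X e₁) (X e₂) else 1,
    fun e₁ e₂ => if_congr (by rw [Finset.inter_comm]) (K_symm _ _) rfl⟩

/-- `B_H(X)`: the product of `K(X(e₁),X(e₂))` over unordered pairs of distinct
hyperedges sharing an odd number of vertices. -/
def BE {N : ℕ} (E : Finset (Finset (Fin N))) (X : Finset (Fin N) → ℝ × ℝ) : ℝ :=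
  ∏ p ∈ E.sym2.filter (fun p => ¬ p.IsDiag), pairSign X p

/-- `b_H`: the expectation of `B_H(X)` over i.i.d. chords with law `ν`. -/
def bT {N : ℕ} (E : Finset (Finset (Fin N))) : ℝ :=
  ∫ X : Finset (Fin N) → ℝ × ℝ, BE E X ∂(Measure.pi fun _ => nu)

/-- `ρ = ((q−1)! β² / 2^{q+1})^{1/(q−1)}`. -/
def rho (q : ℕ) (β : ℝ) : ℝ :=
  (((q - 1).factorial * β ^ 2 / 2 ^ (q + 1) : ℝ)) ^ ((q : ℝ) - 1)⁻¹

/-- `μ_v = (ρ^{v−1}/v!) Σ_{T ∈ 𝒯_v} b_T`. -/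
def mu (q : ℕ) (β : ℝ) (v : ℕ) : ℝ :=
  rho q β ^ (v - 1) / v.factorial * ∑ E ∈ trees q v, bT E

/-- The power series `Φ(z) = Σ_{v ≥ 1} μ_v z^v` (complex version). -/
def PhiC (q : ℕ) (β : ℝ) (z : ℂ) : ℂ :=
  ∑' v : ℕ, (mu q β (v + 1) : ℂ) * z ^ (v + 1)

/-- The power series `Φ(t) = Σ_{v ≥ 1} μ_v t^v` (real version). -/
def PhiR (q : ℕ) (β : ℝ) (t : ℝ) : ℝ :=
  ∑' v : ℕ, mu q β (v + 1) * t ^ (v + 1)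

/-- The quadratic form on `ℂ^N` with `Q(x) = ½ Σ x_i²`, so that the Clifford
relation reads `ψ_i ψ_j + ψ_j ψ_i = δ_{ij}`. -/
def Qf (N : ℕ) : QuadraticForm ℂ (Fin N → ℂ) :=
  QuadraticMap.weightedSumSquares ℂ (fun _ : Fin N => (1 / 2 : ℂ))

/-- The complex Clifford algebra with `N` Majorana generators. -/
abbrev Cliff (N : ℕ) := CliffordAlgebra (Qf N)

/-- The Majorana generator `ψ_i`. -/
def psi {N : ℕ} (i : Fin N) : Cliff N :=
  CliffordAlgebra.ι (Qf N) (Pi.single i 1)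

/-- `ψ_I = i^{q/2} ψ_{i₁} ⋯ ψ_{i_q}` for `I = {i₁ < ⋯ < i_q}`. -/
def psiSet {N : ℕ} (q : ℕ) (I : Finset (Fin N)) : Cliff N :=
  (Complex.I) ^ (q / 2) • ((I.sort (· ≤ ·)).map psi).prod

/-- The sign `B(I₁,…,I_m) ∈ {±1}` determined by
`ψ_{I₁} ⋯ ψ_{I_m} = B(I₁,…,I_m) 2^{-qm/2} 1`. -/
def signB {N : ℕ} (q : ℕ) (l : List (Finset (Fin N))) : ℝ :=
  if (l.map (psiSet q)).prod = (((2 : ℂ) ^ (q * l.length / 2))⁻¹) • (1 : Cliff N) then 1 else -1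

/-- `b(H) = Σ_{(I₁,…,I_m) ∈ w(H)} B(I₁,…,I_m)` for a multi-hypergraph with
multiplicity function `r` and total multiplicity `m`, the sum running over
all ordered sequences in which each hyperedge `e` appears exactly `r e` times. -/
def bMulti {N : ℕ} (q : ℕ) (r : Finset (Fin N) → ℕ) (m : ℕ) : ℝ :=
  ∑ f : Fin m → Finset (Fin N),
    if (∀ e, (Finset.univ.filter (fun i => f i = e)).card = r e)
    then signB q (List.ofFn f) else 0

/-- `r` describes a member of `ℋ_{v,Δ}`: a connected `q`-uniform multi-hypergraph on the
vertex set `{1,…,v}` with even multiplicities and total multiplicity `2(v−1+Δ)/(q−1)`. -/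
def IsMultiHG (q v Δ : ℕ) (r : Finset (Fin v) → ℕ) : Prop :=
  (∀ e, r e ≠ 0 → e.card = q) ∧ (∀ e, Even (r e)) ∧
    (∀ a b : Fin v,
      Relation.ReflTransGen (fun a b => ∃ e, r e ≠ 0 ∧ a ∈ e ∧ b ∈ e) a b) ∧
    (q - 1) * (∑ e, r e) = 2 * (v - 1 + Δ)

/-- `σ = ((q−1)!/n^{q−1})^{1/2}`. -/
def sigma (q n : ℕ) : ℝ := Real.sqrt ((q - 1).factorial / (n : ℝ) ^ (q - 1))

/-- `μ_{v,Δ} = (n^{v−1}/v!) Σ_{H ∈ ℋ_{v,Δ}} (β 2^{-q/2} σ)^{m(H)} b(H)/m(H)!`.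
Multi-hypergraphs are encoded by their multiplicity functions; since the total
multiplicity is at most `2(v−1+Δ)`, multiplicities are encoded in `Fin (2(v−1+Δ)+1)`. -/
def muVD (q n : ℕ) (β : ℝ) (v Δ : ℕ) : ℝ :=
  (n : ℝ) ^ (v - 1) / v.factorial *
    ∑ r : Finset (Fin v) → Fin (2 * (v - 1 + Δ) + 1),
      if IsMultiHG q v Δ (fun e => (r e : ℕ)) then
        (β * ((2 : ℝ) ^ (q / 2))⁻¹ * sigma q n) ^ (∑ e, (r e : ℕ)) *
          bMulti q (fun e => (r e : ℕ)) (∑ e, (r e : ℕ)) / (∑ e, (r e : ℕ)).factorial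
      else 0

section Sorting

variable {ι A : Type*} [LinearOrder ι] [Ring A]

/-- The product of the commutation signs `s` over all inversions of the list. -/
def invSign (s : ι → ι → ℤ) : List ι → ℤ
  | [] => 1
  | i :: l => (l.map fun j => if j < i then s i j else 1).prod * invSign s l

lemma mul_prod_orderedInsert (a : ι → A) (s : ι → ι → ℤ) (i : ι) (l : List ι)
    (hl : l.Pairwise (· ≤ ·)) (h : ∀ j ∈ l, a i * a j = s i j • (a j * a i)) :
    a i * (l.map a).prod = (l.map fun j => if j < i then s i j else 1).prod •
      ((l.orderedInsert (· ≤ ·) i).map a).prod := by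
  induction l with
  | nil => simp
  | cons j l ih =>
    rw [List.pairwise_cons] at hl
    by_cases hij : i ≤ j
    · have : ∀ x ∈ l, (if x < i then s i x else 1) = 1 := fun x hx =>
        if_neg (not_lt.2 (hij.trans (hl.1 x hx)))
      have h1 : (l.map fun j => if j < i then s i j else 1).prod = 1 := by
        rw [List.map_congr_left this]; simp
      simp [List.orderedInsert, hij, h1]
    · have ih' := ih hl.2 fun x hx => h x (List.mem_cons_of_mem _ hx)
      have hji : j < i := not_le.1 hij
      simp only [List.map_cons, List.prod_cons, List.orderedInsert, hij, if_false, if_pos hji]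
      rw [← mul_assoc, h j (by simp), smul_mul_assoc, mul_assoc, ih', mul_smul_comm, mul_smul]

lemma prod_map_eq_invSign_smul (a : ι → A) (s : ι → ι → ℤ) (l : List ι)
    (h : ∀ i ∈ l, ∀ j ∈ l, i ≠ j → a i * a j = s i j • (a j * a i)) (hs : ∀ i, s i i = 1) :
    (l.map a).prod = invSign s l • ((l.insertionSort (· ≤ ·)).map a).prod := by
  induction l with
  | nil => simp [invSign]
  | cons i l ih =>
    have ih' := ih fun x hx y hy =>
      h x (List.mem_cons_of_mem _ hx) y (List.mem_cons_of_mem _ hy)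
    have key := mul_prod_orderedInsert a s i (l.insertionSort (· ≤ ·))
      (List.pairwise_insertionSort _ l) (by
        intro j hj
        rw [List.mem_insertionSort] at hj
        by_cases hij : i = j
        · subst hij; simp [hs]
        · exact h i (by simp) j (List.mem_cons_of_mem _ hj) hij)
    have hperm : ((l.insertionSort (· ≤ ·)).map fun j => if j < i then s i j else 1).prod =
        (l.map fun j => if j < i then s i j else 1).prod :=
      ((List.perm_insertionSort _ l).map _).prod_eq
    rw [List.map_cons, List.prod_cons, ih', mul_smul_comm, key, hperm, invSign,
      List.insertionSort_cons, smul_smul, mul_comm]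

lemma prod_map_of_pairwise_of_even_count (a : ι → A) (c : A) (hc : ∀ x, Commute c x) :
    ∀ l : List ι, l.Pairwise (· ≤ ·) → (∀ i ∈ l, a i * a i = c) → (∀ i, Even (l.count i)) →
      (l.map a).prod = c ^ (l.length / 2)
  | [], _, _, _ => by simp
  | [i], _, _, h => by have := h i; simp at this
  | i :: j :: l, hl, ha, h => by
    have hij : i = j := by
      by_contra hne
      have h0 : i ∈ j :: l := by
        by_contra hmem
        have := h i
        rw [List.count_cons_self, List.count_eq_zero_of_not_mem hmem] at this
        simp at this
      have h1 : i ∈ l := (List.mem_cons.1 h0).resolve_left hne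
      rw [List.pairwise_cons, List.pairwise_cons] at hl
      exact hne (le_antisymm (hl.1 j (by simp)) (hl.2.1 i h1))
    subst hij
    have ih := prod_map_of_pairwise_of_even_count a c hc l
      (List.Pairwise.of_cons (List.Pairwise.of_cons hl))
      (fun x hx => ha x (by simp [hx])) (fun x => by
        have := h x
        by_cases hx : i = x
        · subst hx
          simpa [Nat.even_add_one] using this
        · simpa [List.count_cons, hx] using this)
    rw [List.map_cons, List.map_cons, List.prod_cons, List.prod_cons, ih, ← mul_assoc,
      ha i (by simp), ← pow_succ']
    congr 1
    simp only [List.length_cons]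
    omega

lemma invSign_ofFn (s : ι → ι → ℤ) {m : ℕ} (f : Fin m → ι) :
    invSign s (List.ofFn f) =
      ∏ x, ∏ y, if x < y ∧ f y < f x then s (f x) (f y) else 1 := by
  induction m with
  | zero => simp [invSign]
  | succ m ih =>
    rw [List.ofFn_succ, invSign, ih, Fin.prod_univ_succ]
    congr 1
    · simp [Fin.prod_univ_succ, List.map_ofFn, List.prod_ofFn]
    · refine Finset.prod_congr rfl fun x _ => ?_
      simp [Fin.prod_univ_succ]

lemma count_ofFn {m : ℕ} (f : Fin m → ι) (i : ι) :
    (List.ofFn f).count i = (Finset.univ.filter fun x => f x = i).card := by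
  induction m with
  | zero => simp
  | succ m ih =>
    rw [List.ofFn_succ, List.count_cons, ih, Fin.card_filter_univ_succ]
    by_cases h : f 0 = i <;> simp [h]

end Sorting

section Clifford

variable {N : ℕ}

lemma psi_mul_self (i : Fin N) : psi i * psi i = (1 / 2 : ℂ) • (1 : Cliff N) := by
  rw [psi, CliffordAlgebra.ι_sq_scalar, Algebra.algebraMap_eq_smul_one]
  congr 1
  simp [Qf, QuadraticMap.weightedSumSquares_apply, Pi.single_apply]

lemma psi_mul_psi {i j : Fin N} (h : i ≠ j) : psi i * psi j = (-1 : ℤ) • (psi j * psi i) := by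
  have : psi i * psi j + psi j * psi i = 0 := by
    rw [psi, psi, CliffordAlgebra.ι_mul_ι_add_swap_of_isOrtho]
    simp only [QuadraticMap.isOrtho_def, Qf, QuadraticMap.weightedSumSquares_apply]
    rw [← Finset.sum_add_distrib]
    refine Finset.sum_congr rfl fun x _ => ?_
    by_cases hx : x = i
    · subst hx; simp [h]
    · simp [hx]
  rw [neg_smul, one_smul]
  exact eq_neg_of_add_eq_zero_left this

lemma mul_list_prod_of_smul_comm {κ A : Type*} [Ring A] (x : A) (y : κ → A) (s : κ → ℤ)
    (l : List κ) (h : ∀ j ∈ l, x * y j = s j • (y j * x)) :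
    x * (l.map y).prod = (l.map s).prod • ((l.map y).prod * x) := by
  induction l with
  | nil => simp
  | cons j l ih =>
    rw [List.map_cons, List.map_cons, List.prod_cons, List.prod_cons, ← mul_assoc,
      h j (by simp), smul_mul_assoc, mul_assoc, ih fun k hk => h k (List.mem_cons_of_mem _ hk),
      mul_smul_comm, smul_smul, mul_assoc]

lemma list_prod_mul_of_smul_comm {κ A : Type*} [Ring A] (x : A) (y : κ → A) (s : κ → ℤ)
    (l : List κ) (h : ∀ j ∈ l, y j * x = s j • (x * y j)) :
    (l.map y).prod * x = (l.map s).prod • (x * (l.map y).prod) := by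
  induction l with
  | nil => simp
  | cons j l ih =>
    rw [List.map_cons, List.map_cons, List.prod_cons, List.prod_cons, mul_assoc,
      ih fun k hk => h k (List.mem_cons_of_mem _ hk), mul_smul_comm, ← mul_assoc, h j (by simp),
      smul_mul_assoc, smul_smul, mul_assoc, mul_comm]

lemma list_prod_sort {M κ : Type*} [CommMonoid M] [LinearOrder κ]
    [DecidableRel ((· ≤ ·) : κ → κ → Prop)] (I : Finset κ) (f : κ → M) :
    ((I.sort (· ≤ ·)).map f).prod = ∏ i ∈ I, f i := by
  rw [Finset.prod_eq_multiset_prod, ← Finset.sort_eq I (· ≤ ·), Multiset.map_coe,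
    Multiset.prod_coe]

lemma psiSet_mul_psiSet {q : ℕ} (hq : Even q) {I J : Finset (Fin N)} (hJ : J.card = q) :
    psiSet q I * psiSet q J = ((-1 : ℤ) ^ (I ∩ J).card) • (psiSet q J * psiSet q I) := by
  have h1 : ∀ i : Fin N, psi i * ((J.sort (· ≤ ·)).map psi).prod =
      (if i ∈ J then (-1 : ℤ) else 1) • (((J.sort (· ≤ ·)).map psi).prod * psi i) := by
    intro i
    rw [mul_list_prod_of_smul_comm (psi i) psi (fun j => if j = i then 1 else -1), list_prod_sort,
      Finset.prod_ite, Finset.prod_const_one, one_mul, Finset.prod_const]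
    · congr 1
      rw [Finset.filter_ne']
      by_cases hi : i ∈ J
      · rw [Finset.card_erase_of_mem hi, if_pos hi, Odd.neg_one_pow]
        rw [hJ]
        have : 0 < q := hJ ▸ Finset.card_pos.2 ⟨i, hi⟩
        exact Nat.Even.sub_odd this hq odd_one
      · rw [Finset.erase_eq_of_notMem hi, if_neg hi, hJ, hq.neg_one_pow]
    · intro j _
      by_cases hji : j = i
      · subst hji; simp
      · rw [if_neg hji, psi_mul_psi (Ne.symm hji)]
  have h2 := list_prod_mul_of_smul_comm ((J.sort (· ≤ ·)).map psi).prod psi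
    (fun i => if i ∈ J then (-1 : ℤ) else 1) (I.sort (· ≤ ·)) fun i _ => h1 i
  rw [list_prod_sort, Finset.prod_ite, Finset.prod_const_one, mul_one, Finset.prod_const,
    Finset.filter_mem_eq_inter] at h2
  simp only [psiSet, smul_mul_smul_comm, h2]
  rw [smul_comm]

lemma list_prod_psi_mul_self (l : List (Fin N)) (hl : l.Nodup) :
    (l.map psi).prod * (l.map psi).prod =
      ((-1 : ℂ) ^ (l.length.choose 2) * (1 / 2) ^ l.length) • (1 : Cliff N) := by
  induction l with
  | nil => simp
  | cons i l ih =>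
    rw [List.nodup_cons] at hl
    have h := list_prod_mul_of_smul_comm (psi i) psi (fun _ => -1) l fun j hj =>
      psi_mul_psi fun hji => hl.1 (hji ▸ hj)
    rw [List.map_const', List.prod_replicate] at h
    rw [List.map_cons, List.prod_cons, mul_assoc, ← mul_assoc _ (psi i), h, smul_mul_assoc,
      mul_smul_comm, mul_assoc, ← mul_assoc, psi_mul_self, ih hl.2, List.length_cons,
      Nat.choose_succ_succ' l.length 1, Nat.choose_one_right, smul_mul_smul_comm, mul_one,
      ← Int.cast_smul_eq_zsmul ℂ, smul_smul]
    congr 1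
    push_cast
    ring

lemma psiSet_mul_self {q : ℕ} (hq : Even q) {I : Finset (Fin N)} (hI : I.card = q) :
    psiSet q I * psiSet q I = ((2 : ℂ) ^ q)⁻¹ • (1 : Cliff N) := by
  obtain ⟨t, rfl⟩ := hq
  rw [psiSet, smul_mul_smul_comm, list_prod_psi_mul_self _ (Finset.sort_nodup _ _),
    Finset.length_sort, hI, smul_smul]
  congr 1
  have h1 : (t + t) / 2 = t := by omega
  have h2 : (-1 : ℂ) ^ ((t + t).choose 2) = (-1) ^ t := by
    rcases t with _ | t
    · simp
    have : (t + 1 + (t + 1)).choose 2 = (2 * t + 1) * (t + 1) := by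
      rw [Nat.choose_two_right]
      have : t + 1 + (t + 1) - 1 = 2 * t + 1 := by omega
      rw [this]
      refine Nat.div_eq_of_eq_mul_left two_pos ?_
      ring
    rw [this, pow_mul]
    congr 1
    exact Odd.neg_one_pow ⟨t, rfl⟩
  rw [h1, h2, ← mul_pow, Complex.I_mul_I, ← mul_assoc, ← mul_pow]
  simp

lemma prod_psiSet_eq {κ : Type*} [LinearOrder κ] {q : ℕ} (hq : Even q)
    (ed : κ → Finset (Fin N)) (hcard : ∀ i, (ed i).card = q) (l : List κ)
    (hl : ∀ i, Even (l.count i)) (hlen : Even l.length) :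
    (l.map (psiSet q ∘ ed)).prod =
      ((invSign (fun i j => (-1) ^ (ed i ∩ ed j).card) l : ℤ) *
        ((2 : ℂ) ^ (q * l.length / 2))⁻¹) • (1 : Cliff N) := by
  rw [prod_map_eq_invSign_smul (psiSet q ∘ ed) (fun i j => (-1) ^ (ed i ∩ ed j).card) l
      (fun i _ j _ _ => psiSet_mul_psiSet hq (hcard j))
      (fun i => by rw [Finset.inter_self, hcard, hq.neg_one_pow]),
    prod_map_of_pairwise_of_even_count (psiSet q ∘ ed) (((2 : ℂ) ^ q)⁻¹ • (1 : Cliff N))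
      (fun x => (Commute.one_left x).smul_left _) _ (List.pairwise_insertionSort _ l)
      (fun i _ => psiSet_mul_self hq (hcard i))
      (fun i => by rw [(List.perm_insertionSort _ l).count_eq]; exact hl i),
    List.length_insertionSort, smul_pow, one_pow, ← Int.cast_smul_eq_zsmul ℂ, smul_smul]
  congr 2
  rw [inv_pow, ← pow_mul, Nat.mul_div_assoc q hlen.two_dvd]

lemma signB_map {q k : ℕ} (hq : Even q)
    (ed : Fin k → Finset (Fin N)) (hcard : ∀ i, (ed i).card = q) {m : ℕ} (f : Fin m → Fin k)
    (hf : ∀ i, Even (Finset.univ.filter fun x => f x = i).card) (hm : Even m) :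
    signB q (List.ofFn (ed ∘ f)) =
      ∏ x, ∏ y, if x < y ∧ f y < f x then (-1) ^ (ed (f x) ∩ ed (f y)).card else (1 : ℝ) := by
  have key := prod_psiSet_eq hq ed hcard (List.ofFn f) (fun i => by rw [count_ofFn]; convert hf i)
    (by simpa using hm)
  have hlist : List.map (psiSet q) (List.ofFn (ed ∘ f)) =
      List.map (psiSet q ∘ ed) (List.ofFn f) := by
    simp [List.map_ofFn, Function.comp_assoc]
  rw [signB, hlist, key, List.length_ofFn, List.length_ofFn]
  have hP := invSign_ofFn (fun i j => (-1) ^ (ed i ∩ ed j).card) f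
  have hsign : invSign (fun i j => (-1) ^ (ed i ∩ ed j).card) (List.ofFn f) = 1 ∨
      invSign (fun i j => (-1) ^ (ed i ∩ ed j).card) (List.ofFn f) = -1 := by
    rw [← Int.isUnit_iff, hP]
    refine Finset.prod_induction _ IsUnit (fun _ _ => IsUnit.mul) isUnit_one fun x _ => ?_
    refine Finset.prod_induction _ IsUnit (fun _ _ => IsUnit.mul) isUnit_one fun y _ => ?_
    split_ifs
    · exact isUnit_one.neg.pow _
    · exact isUnit_one
  have hR : (∏ x, ∏ y, if x < y ∧ f y < f x then (-1) ^ (ed (f x) ∩ ed (f y)).card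
      else (1 : ℝ)) = (invSign (fun i j => (-1) ^ (ed i ∩ ed j).card) (List.ofFn f) : ℤ) := by
    rw [hP]
    push_cast
    rfl
  rw [hR]
  rcases hsign with h | h
  · rw [h]; simp
  · rw [h, if_neg]
    · simp
    · intro hc
      have hinv : (2 : ℂ) ^ (q * m / 2) ≠ 0 := pow_ne_zero _ two_ne_zero
      have h2 := smul_left_injective ℂ (one_ne_zero : (1 : Cliff N) ≠ 0) hc
      have h3 : ((2 : ℂ) ^ (q * m / 2))⁻¹ ≠ 0 := inv_ne_zero hinv
      push_cast at h2
      have h4 : (2 : ℂ) * ((2 : ℂ) ^ (q * m / 2))⁻¹ = 0 := by linear_combination -h2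
      simp at h4

end Clifford

section Chords

variable {N k : ℕ}

/-- The positions `Fin (k + k)` carry each of the `k` letters twice. -/
def letter (k : ℕ) (x : Fin (k + k)) : Fin k := Sum.elim id id (finSumFinEquiv.symm x)

/-- The chords whose endpoints are the coordinates of `U`. -/
def chord (U : Fin (k + k) → ℝ) (i : Fin k) : ℝ × ℝ :=
  (min (U (Fin.castAdd k i)) (U (Fin.natAdd k i)), max (U (Fin.castAdd k i)) (U (Fin.natAdd k i)))

/-- The product of `K` over the pairs of hyperedges of `ed` with odd intersection. -/
def crossSign (ed : Fin k → Finset (Fin N)) (X : Fin k → ℝ × ℝ) : ℝ :=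
  ∏ i, ∏ j, if i < j ∧ Odd (ed i ∩ ed j).card then K (X i) (X j) else 1

lemma BE_eq_crossSign {E : Finset (Finset (Fin N))} (ed : Fin k → Finset (Fin N))
    (hed : Function.Injective ed) (hE : ∀ e, e ∈ E ↔ ∃ i, ed i = e)
    (X : Finset (Fin N) → ℝ × ℝ) : BE E X = crossSign ed (X ∘ ed) := by
  have h1 : crossSign ed (X ∘ ed) = ∏ p : Fin k × Fin k with p.1 < p.2,
      pairSign X s(ed p.1, ed p.2) := by
    rw [crossSign, ← Fintype.prod_prod_type', Finset.prod_filter]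
    refine Finset.prod_congr rfl fun p _ => ?_
    by_cases hp : p.1 < p.2 <;> simp [hp, pairSign]
  rw [h1, BE]
  symm
  refine Finset.prod_bij (fun p _ => s(ed p.1, ed p.2)) ?_ ?_ ?_ ?_
  · rintro ⟨i, j⟩ hij
    simp only [Finset.mem_filter, Finset.mem_univ, true_and] at hij
    simp only [Finset.mem_filter, Finset.mk_mem_sym2_iff, Sym2.mk_isDiag_iff, hE]
    exact ⟨⟨⟨i, rfl⟩, ⟨j, rfl⟩⟩, fun h => hij.ne (hed h)⟩
  · rintro ⟨i, j⟩ hij ⟨i', j'⟩ hij' h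
    simp only [Finset.mem_filter, Finset.mem_univ, true_and] at hij hij'
    rw [Sym2.eq_iff] at h
    rcases h with ⟨h1, h2⟩ | ⟨h1, h2⟩
    · exact Prod.ext (hed h1) (hed h2)
    · have := hed h1; have := hed h2
      subst_vars
      exact absurd hij hij'.asymm
  · intro p hp
    induction p with | _ a b
    simp only [Finset.mem_filter, Finset.mk_mem_sym2_iff, Sym2.mk_isDiag_iff, hE] at hp
    obtain ⟨⟨⟨i, rfl⟩, ⟨j, rfl⟩⟩, hne⟩ := hp
    rcases lt_trichotomy i j with h | h | h
    · exact ⟨(i, j), by simpa using h, rfl⟩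
    · exact absurd (congrArg ed h) hne
    · exact ⟨(j, i), by simpa using h, Sym2.eq_swap⟩
  · intros; rfl

lemma K_min_max {a b c d : ℝ} (hab : a ≠ b) (hac : a ≠ c) (had : a ≠ d) (hbc : b ≠ c)
    (hbd : b ≠ d) (hcd : c ≠ d) :
    K (min a b, max a b) (min c d, max c d) =
      ((if a < c then -1 else 1) * (if a < d then -1 else 1)) *
        ((if b < c then -1 else 1) * (if b < d then -1 else 1)) := by
  unfold K
  rcases lt_or_gt_of_ne hab with h1 | h1 <;> rcases lt_or_gt_of_ne hac with h2 | h2 <;>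
  rcases lt_or_gt_of_ne had with h3 | h3 <;> rcases lt_or_gt_of_ne hbc with h4 | h4 <;>
  rcases lt_or_gt_of_ne hbd with h5 | h5 <;> rcases lt_or_gt_of_ne hcd with h6 | h6 <;>
  first
  | (exfalso; linarith)
  | simp [h2, h3, h4, h5, h1.le, h6.le, h2.not_gt, h3.not_gt, h4.not_gt,
      h5.not_gt]

lemma letter_castAdd (i : Fin k) : letter k (Fin.castAdd k i) = i := by
  rw [letter, finSumFinEquiv_symm_apply_castAdd, Sum.elim_inl, id]

lemma letter_natAdd (i : Fin k) : letter k (Fin.natAdd k i) = i := by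
  rw [letter, finSumFinEquiv_symm_apply_natAdd, Sum.elim_inr, id]

lemma castAdd_ne_natAdd (i j : Fin k) : Fin.castAdd k i ≠ Fin.natAdd k j := by
  intro h
  have := congrArg Fin.val h
  simp only [Fin.val_castAdd, Fin.val_natAdd] at this
  omega

lemma card_filter_letter (i : Fin k) :
    (Finset.univ.filter fun x => letter k x = i).card = 2 := by
  have : (Finset.univ.filter fun x => letter k x = i) =
      {Fin.castAdd k i, Fin.natAdd k i} := by
    ext x
    simp only [Finset.mem_filter, Finset.mem_univ, true_and, Finset.mem_insert,
      Finset.mem_singleton]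
    constructor
    · rintro rfl
      obtain ⟨y | y, rfl⟩ := finSumFinEquiv.surjective x
      · left
        rw [finSumFinEquiv_apply_left, letter_castAdd]
      · right
        rw [finSumFinEquiv_apply_right, letter_natAdd]
    · rintro (rfl | rfl)
      · exact letter_castAdd i
      · exact letter_natAdd i
  rw [this, Finset.card_pair (castAdd_ne_natAdd i i)]

lemma prod_letter {M : Type*} [CommMonoid M] (g : Fin (k + k) → M) :
    ∏ x, g x = ∏ i, g (Fin.castAdd k i) * g (Fin.natAdd k i) := by
  rw [Fin.prod_univ_add, Finset.prod_mul_distrib]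

lemma crossSign_chord_eq_signB {q : ℕ} (hq : Even q) (ed : Fin k → Finset (Fin N))
    (hcard : ∀ i, (ed i).card = q) (U : Fin (k + k) → ℝ) (π : Equiv.Perm (Fin (k + k)))
    (hU : StrictMono (U ∘ π)) :
    crossSign ed (chord U) = signB q (List.ofFn (ed ∘ letter k ∘ π)) := by
  have hUinj : Function.Injective U := by
    have := hU.injective.comp π.symm.injective
    simpa [Function.comp_assoc] using this
  rw [signB_map hq ed hcard]
  · have h1 : (∏ x, ∏ y, if x < y ∧ (letter k ∘ π) y < (letter k ∘ π) x then
        (-1) ^ (ed ((letter k ∘ π) x) ∩ ed ((letter k ∘ π) y)).card else (1 : ℝ)) =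
        ∏ x, ∏ y, if U x < U y ∧ letter k y < letter k x then
          (-1) ^ (ed (letter k x) ∩ ed (letter k y)).card else (1 : ℝ) := by
      refine Fintype.prod_equiv π _ _ fun x => Fintype.prod_equiv π _ _ fun y => ?_
      have : U (π x) < U (π y) ↔ x < y := hU.lt_iff_lt
      simp only [Function.comp_apply, this]
    rw [h1, prod_letter, crossSign, Finset.prod_comm]
    refine Finset.prod_congr rfl fun i _ => ?_
    rw [prod_letter, prod_letter, ← Finset.prod_mul_distrib]
    refine Finset.prod_congr rfl fun j _ => ?_
    simp only [letter_castAdd, letter_natAdd]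
    by_cases hji : j < i
    · have hne : ∀ x y : Fin (k + k), x ≠ y → U x ≠ U y := fun x y h => hUinj.ne h
      have hij := hji.ne
      have hK := K_symm (chord U j) (chord U i)
      have hK2 : K (chord U i) (chord U j) = _ := K_min_max (hne _ _ (castAdd_ne_natAdd i i))
        (hne (Fin.castAdd k i) (Fin.castAdd k j) (by simpa using hij.symm))
        (hne _ _ (castAdd_ne_natAdd i j))
        (hne _ _ (castAdd_ne_natAdd j i).symm)
        (hne (Fin.natAdd k i) (Fin.natAdd k j) (by simpa using hij.symm))
        (hne _ _ (castAdd_ne_natAdd j j))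
      rw [hK, hK2, Finset.inter_comm]
      simp only [hji, and_true, true_and]
      by_cases ho : Odd (ed i ∩ ed j).card
      · simp only [ho, if_true, ho.neg_one_pow]
      · simp only [ho, if_false, (Nat.not_odd_iff_even.1 ho).neg_one_pow, ite_self, mul_one]
    · simp [hji]
  · intro i
    have : (Finset.univ.filter fun x => (letter k ∘ π) x = i).card = 2 := by
      rw [← card_filter_letter i]
      refine Finset.card_bij (fun x _ => π x) ?_ ?_ ?_
      · simp
      · intro a _ b _ h; exact π.injective h
      · intro b hb; exact ⟨π.symm b, by simpa using hb, by simp⟩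
    rw [this]; exact even_two
  · exact ⟨k, rfl⟩

lemma sum_crossSign_comp_perm {q : ℕ} (hq : Even q) (ed : Fin k → Finset (Fin N))
    (hcard : ∀ i, (ed i).card = q) (U : Fin (k + k) → ℝ) (hU : Function.Injective U) :
    ∑ σ : Equiv.Perm (Fin (k + k)), crossSign ed (chord (U ∘ σ)) =
      ∑ σ : Equiv.Perm (Fin (k + k)), signB q (List.ofFn (ed ∘ letter k ∘ σ)) := by
  have hmono : StrictMono (U ∘ Tuple.sort U) :=
    (Tuple.monotone_sort U).strictMono_of_injective (hU.comp (Tuple.sort U).injective)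
  rw [← Equiv.sum_comp ((Equiv.inv _).trans (Equiv.mulRight (Tuple.sort U)))
    fun σ : Equiv.Perm (Fin (k + k)) => signB q (List.ofFn (ed ∘ letter k ∘ σ))]
  refine Finset.sum_congr rfl fun σ _ => ?_
  refine crossSign_chord_eq_signB hq ed hcard (U ∘ σ) _ ?_
  convert hmono using 1
  ext x
  simp

lemma sum_perm_comp {m : ℕ} (w : Fin m → Finset (Fin N))
    (h : (Fin m → Finset (Fin N)) → ℝ) :
    ∑ σ : Equiv.Perm (Fin m), h (w ∘ σ) =
      (∏ i, ((Finset.univ.filter fun x => w x = i).card.factorial : ℝ)) *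
        ∑ f : Fin m → Finset (Fin N), if ∀ i, (Finset.univ.filter fun x => f x = i).card =
          (Finset.univ.filter fun x => w x = i).card then h f else 0 := by
  have hfib : ∀ f : Fin m → Finset (Fin N),
      ((Finset.univ.filter fun σ : Equiv.Perm (Fin m) => w ∘ σ = f).card : ℝ) =
      if ∀ i, (Finset.univ.filter fun x => f x = i).card =
          (Finset.univ.filter fun x => w x = i).card then
        (∏ i, ((Finset.univ.filter fun x => w x = i).card.factorial : ℝ)) else 0 := by
    intro f
    split_ifs with hf
    · have hex : ∃ σ₀ : Equiv.Perm (Fin m), w ∘ σ₀ = f := by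
        have he : ∀ i, Nonempty ({x // f x = i} ≃ {x // w x = i}) := fun i => by
          rw [← Fintype.card_eq, Fintype.card_subtype, Fintype.card_subtype]
          exact hf i
        refine ⟨Equiv.ofFiberEquiv fun i => (he i).some, ?_⟩
        funext x
        exact Equiv.ofFiberEquiv_map _ _
      obtain ⟨σ₀, rfl⟩ := hex
      have hc := DomMulAct.stabilizer_card (f := w)
      rw [Fintype.card_subtype] at hc
      simp only [Fintype.card_subtype] at hc
      have : (Finset.univ.filter fun σ : Equiv.Perm (Fin m) => w ∘ σ = w ∘ σ₀).card =
          (Finset.univ.filter fun σ : Equiv.Perm (Fin m) => w ∘ σ = w).card := by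
        refine Finset.card_bij (fun σ _ => σ * σ₀⁻¹) ?_ ?_ ?_
        · intro σ hσ
          simp only [Finset.mem_filter, Finset.mem_univ, true_and] at hσ ⊢
          rw [Equiv.Perm.coe_mul, ← Function.comp_assoc, hσ]
          funext x
          simp
        · intro a _ b _ hab; exact mul_right_cancel hab
        · intro b hb
          simp only [Finset.mem_filter, Finset.mem_univ, true_and] at hb
          refine ⟨b * σ₀, ?_, by simp⟩
          simp only [Finset.mem_filter, Finset.mem_univ, true_and]
          rw [Equiv.Perm.coe_mul, ← Function.comp_assoc, hb]
      rw [this, hc]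
      push_cast
      rfl
    · rw [Nat.cast_eq_zero, Finset.card_eq_zero, Finset.filter_eq_empty_iff]
      rintro σ - rfl
      refine hf fun i => Finset.card_bij (fun x _ => σ x) ?_ ?_ ?_
      · simp
      · intro a _ b _ h; exact σ.injective h
      · intro b hb; exact ⟨σ.symm b, by simpa using hb, by simp⟩
  rw [← Finset.sum_fiberwise Finset.univ (fun σ : Equiv.Perm (Fin m) => w ∘ σ), Finset.mul_sum]
  refine Finset.sum_congr rfl fun f _ => ?_
  rw [Finset.sum_congr rfl fun σ hσ => congrArg h (Finset.mem_filter.1 hσ).2,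
    Finset.sum_const, nsmul_eq_mul, hfib f, ite_mul, zero_mul, mul_ite, mul_zero]

end Chords

section Averaging

open ProbabilityTheory

lemma measurePreserving_comp_injective {α β Ω : Type*} [Fintype α] [Fintype β]
    [MeasurableSpace Ω] (μ : Measure Ω) [IsProbabilityMeasure μ] {g : α → β}
    (hg : Function.Injective g) :
    MeasurePreserving (fun X : β → Ω => X ∘ g) (Measure.pi fun _ => μ)
      (Measure.pi fun _ => μ) := by
  refine ⟨by fun_prop, ?_⟩
  have hind : iIndepFun (fun (i : β) (X : β → Ω) => X i) (Measure.pi fun _ => μ) :=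
    iIndepFun_pi (X := fun _ => id) fun _ => aemeasurable_id
  have h := (iIndepFun_iff_map_fun_eq_pi_map
    fun i => (measurable_pi_apply (g i)).aemeasurable).1 (hind.precomp hg)
  have heval : ∀ i : β, Measure.map (fun X : β → Ω => X i) (Measure.pi fun _ => μ) = μ :=
    fun i => (measurePreserving_eval (fun _ : β => μ) i).map_eq
  simp only [heval] at h
  exact h

/-- The uniform law on the unit interval. -/
def unitLaw : Measure ℝ := volume.restrict (Set.Icc (0 : ℝ) 1)

instance : IsProbabilityMeasure unitLaw := ⟨by simp [unitLaw]⟩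

lemma nu_eq_map : nu = Measure.map (fun p : ℝ × ℝ => (min p.1 p.2, max p.1 p.2))
    (unitLaw.prod unitLaw) := by
  rw [nu, unitLaw, Measure.prod_restrict]
  rfl

instance : IsProbabilityMeasure nu := by
  rw [nu_eq_map]
  exact Measure.isProbabilityMeasure_map (by fun_prop)

variable {N k : ℕ}

lemma measurePreserving_chord :
    MeasurePreserving (chord (k := k)) (Measure.pi fun _ => unitLaw) (Measure.pi fun _ => nu) := by
  have h1 := measurePreserving_comp_injective unitLaw (finSumFinEquiv (m := k) (n := k)).injective
  have h2 := measurePreserving_sumPiEquivProdPi (ι := Fin k) (ι' := Fin k) fun _ => unitLaw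
  have h3 := (measurePreserving_arrowProdEquivProdArrow ℝ ℝ (Fin k) (fun _ => unitLaw)
    (fun _ => unitLaw)).symm
  have h4 : MeasurePreserving
      (fun (Y : Fin k → ℝ × ℝ) i => (min (Y i).1 (Y i).2, max (Y i).1 (Y i).2))
      (Measure.pi fun _ => unitLaw.prod unitLaw) (Measure.pi fun _ => nu) :=
    measurePreserving_pi (fun _ : Fin k => unitLaw.prod unitLaw) (fun _ => nu)
      fun _ => ⟨by fun_prop, nu_eq_map.symm⟩
  exact h4.comp (h3.comp (h2.comp h1))

lemma measurable_K : Measurable fun p : (ℝ × ℝ) × (ℝ × ℝ) => K p.1 p.2 := by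
  unfold K
  refine Measurable.ite ?_ measurable_const measurable_const
  measurability

lemma measurable_crossSign (ed : Fin k → Finset (Fin N)) : Measurable (crossSign ed) := by
  unfold crossSign
  refine Finset.measurable_prod _ fun i _ => Finset.measurable_prod _ fun j _ => ?_
  split_ifs
  · exact measurable_K.comp (f := fun X : Fin k → ℝ × ℝ => (X i, X j))
      ((measurable_pi_apply i).prodMk (measurable_pi_apply j))
  · exact measurable_const

lemma norm_crossSign (ed : Fin k → Finset (Fin N)) (X : Fin k → ℝ × ℝ) :
    ‖crossSign ed X‖ = 1 := by
  unfold crossSign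
  rw [norm_prod]
  refine Finset.prod_eq_one fun i _ => ?_
  rw [norm_prod]
  refine Finset.prod_eq_one fun j _ => ?_
  unfold K
  split_ifs <;> simp

lemma integrable_crossSign_chord (ed : Fin k → Finset (Fin N)) :
    Integrable (fun U => crossSign ed (chord U)) (Measure.pi fun _ => unitLaw) :=
  Integrable.of_bound
    ((measurable_crossSign ed).comp measurePreserving_chord.measurable).aestronglyMeasurable 1
    (ae_of_all _ fun U => (norm_crossSign ed (chord U)).le)

lemma ae_injective {m : ℕ} :
    ∀ᵐ U : Fin m → ℝ ∂(Measure.pi fun _ => unitLaw), Function.Injective U := by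
  have h : ∀ i j : Fin m, i ≠ j →
      ∀ᵐ U : Fin m → ℝ ∂(Measure.pi fun _ => unitLaw), U i ≠ U j := by
    intro i j hij
    simp only [unitLaw]
    rw [← Measure.restrict_pi_pi]
    refine ae_restrict_of_ae ?_
    let L : (Fin m → ℝ) →ₗ[ℝ] ℝ :=
      LinearMap.proj (R := ℝ) (φ := fun _ : Fin m => ℝ) i -
        LinearMap.proj (R := ℝ) (φ := fun _ : Fin m => ℝ) j
    have : LinearMap.ker L ≠ ⊤ := by
      intro htop
      have : (Pi.single i 1 : Fin m → ℝ) ∈ LinearMap.ker L := by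
        rw [htop]; trivial
      simp [L, hij.symm] at this
    have h0 := Measure.addHaar_submodule (volume : Measure (Fin m → ℝ)) _ this
    rw [ae_iff]
    rw [← volume_pi]
    convert h0 using 2
    ext U
    simp [L, sub_eq_zero]
  have h' : ∀ᵐ U : Fin m → ℝ ∂(Measure.pi fun _ => unitLaw), ∀ i j, i ≠ j → U i ≠ U j := by
    refine ae_all_iff.2 fun i => ae_all_iff.2 fun j => ?_
    by_cases hij : i = j
    · simp [hij]
    · filter_upwards [h i j hij] with U hU _
      exact hU
  filter_upwards [h'] with U hU i j hij
  by_contra hne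
  exact hU i j hne hij

lemma bT_eq_integral {E : Finset (Finset (Fin N))} (ed : Fin k → Finset (Fin N))
    (hed : Function.Injective ed) (hE : ∀ e, e ∈ E ↔ ∃ i, ed i = e) :
    bT E = ∫ U : Fin (k + k) → ℝ, crossSign ed (chord U) ∂(Measure.pi fun _ => unitLaw) := by
  have h1 := measurePreserving_comp_injective nu hed
  have h2 := measurePreserving_chord (k := k)
  rw [← integral_map h2.aemeasurable (measurable_crossSign ed).aestronglyMeasurable, h2.map_eq,
    ← h1.map_eq, integral_map h1.aemeasurable (measurable_crossSign ed).aestronglyMeasurable, bT]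
  simp only [BE_eq_crossSign ed hed hE]

lemma factorial_mul_bT {q : ℕ} (hq : Even q) {E : Finset (Finset (Fin N))}
    (ed : Fin k → Finset (Fin N)) (hed : Function.Injective ed)
    (hE : ∀ e, e ∈ E ↔ ∃ i, ed i = e) (hcard : ∀ i, (ed i).card = q) :
    ((k + k).factorial : ℝ) * bT E =
      ∑ σ : Equiv.Perm (Fin (k + k)), signB q (List.ofFn (ed ∘ letter k ∘ σ)) := by
  have hperm : ∀ σ : Equiv.Perm (Fin (k + k)),
      MeasurePreserving (fun U : Fin (k + k) → ℝ => U ∘ σ) (Measure.pi fun _ => unitLaw)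
        (Measure.pi fun _ => unitLaw) :=
    fun σ => measurePreserving_comp_injective unitLaw σ.injective
  have hint := integrable_crossSign_chord ed
  have hσ : ∀ σ : Equiv.Perm (Fin (k + k)),
      ∫ U, crossSign ed (chord (U ∘ σ)) ∂(Measure.pi fun _ => unitLaw) = bT E := by
    intro σ
    rw [bT_eq_integral ed hed hE]
    conv_rhs => rw [← (hperm σ).map_eq]
    rw [integral_map (hperm σ).aemeasurable]
    rw [(hperm σ).map_eq]
    exact hint.aestronglyMeasurable
  have hsum : ∑ σ : Equiv.Perm (Fin (k + k)),
      ∫ U, crossSign ed (chord (U ∘ σ)) ∂(Measure.pi fun _ => unitLaw) =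
      ((k + k).factorial : ℝ) * bT E := by
    rw [Finset.sum_congr rfl fun σ _ => hσ σ, Finset.sum_const, Finset.card_univ,
      Fintype.card_perm, Fintype.card_fin, nsmul_eq_mul]
  have hintσ : ∀ σ ∈ (Finset.univ : Finset (Equiv.Perm (Fin (k + k)))),
      Integrable (fun U : Fin (k + k) → ℝ => crossSign ed (chord (U ∘ σ)))
        (Measure.pi fun _ => unitLaw) :=
    fun σ _ => (hperm σ).integrable_comp_of_integrable hint
  rw [← hsum, ← integral_finsetSum _ hintσ]
  have hae : (fun U : Fin (k + k) → ℝ =>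
      ∑ σ : Equiv.Perm (Fin (k + k)), crossSign ed (chord (U ∘ σ)))
      =ᵐ[Measure.pi fun _ => unitLaw] fun _ =>
        ∑ σ : Equiv.Perm (Fin (k + k)), signB q (List.ofFn (ed ∘ letter k ∘ σ)) := by
    filter_upwards [ae_injective] with U hU
    exact sum_crossSign_comp_perm hq ed hcard U hU
  rw [integral_congr_ae hae, integral_const, probReal_univ, one_smul]

lemma bMulti_eq {q : ℕ} (hq : Even q) (E : Finset (Finset (Fin N)))
    (hcard : ∀ e ∈ E, e.card = q) :
    2 ^ E.card * bMulti q (fun e => if e ∈ E then 2 else 0) (E.card + E.card) =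
      (E.card + E.card).factorial * bT E := by
  set ed : Fin E.card → Finset (Fin N) := fun i => E.equivFin.symm i with hed_def
  have hed : Function.Injective ed := Subtype.val_injective.comp E.equivFin.symm.injective
  have hE : ∀ e, e ∈ E ↔ ∃ i, ed i = e := by
    refine fun e => ⟨fun he => ⟨E.equivFin ⟨e, he⟩, by simp [hed_def]⟩, ?_⟩
    rintro ⟨i, rfl⟩
    exact (E.equivFin.symm i).2
  rw [factorial_mul_bT hq ed hed hE fun i => hcard _ ((hE _).2 ⟨i, rfl⟩)]
  have hfib : ∀ e, (Finset.univ.filter fun x => (ed ∘ letter E.card) x = e).card =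
      if e ∈ E then 2 else 0 := by
    intro e
    split_ifs with he
    · obtain ⟨i, rfl⟩ := (hE e).1 he
      rw [← card_filter_letter i]
      congr 1
      ext x
      simp [hed.eq_iff]
    · rw [Finset.card_eq_zero, Finset.filter_eq_empty_iff]
      rintro x - rfl
      exact he ((hE _).2 ⟨_, rfl⟩)
  have h := sum_perm_comp (ed ∘ letter E.card) fun f => signB q (List.ofFn f)
  simp only [Function.comp_assoc] at h
  rw [h, bMulti]
  simp only [hfib]
  congr 1
  have : ∀ e, (((if e ∈ E then 2 else 0 : ℕ).factorial : ℕ) : ℝ) = if e ∈ E then 2 else 1 := by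
    intro e
    split_ifs <;> simp
  simp only [this]
  rw [Finset.prod_ite_mem, Finset.univ_inter, Finset.prod_const]

end Averaging

section Counting

variable {N : ℕ}

lemma le_mul_card_add_one {q : ℕ} {E : Finset (Finset (Fin N))} (hcard : ∀ e ∈ E, e.card = q)
    (hconn : HGConnected E) : N ≤ (q - 1) * E.card + 1 := by
  rcases Nat.eq_zero_or_pos N with rfl | hN
  · simp
  have : NeZero N := ⟨hN.ne'⟩
  let c : Finset (Fin N) → Fin N := fun e => if h : e.Nonempty then h.choose else 0
  have hc : ∀ e : Finset (Fin N), e.Nonempty → c e ∈ e := fun e h => by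
    simp only [c, dif_pos h]
    exact h.choose_spec
  let S : Finset (Sym2 (Fin N)) := E.biUnion fun e => (e.erase (c e)).image fun x => s(c e, x)
  let G : SimpleGraph (Fin N) := SimpleGraph.fromEdgeSet S
  have hadj : ∀ e ∈ E, ∀ x ∈ e, G.Reachable (c e) x := by
    intro e he x hx
    by_cases hxc : x = c e
    · rw [hxc]
    · refine SimpleGraph.Adj.reachable ?_
      rw [SimpleGraph.fromEdgeSet_adj]
      refine ⟨?_, Ne.symm hxc⟩
      simp only [S, Finset.coe_biUnion, Set.mem_iUnion]
      exact ⟨e, he, Finset.mem_coe.2 (Finset.mem_image.2 ⟨x, Finset.mem_erase.2 ⟨hxc, hx⟩, rfl⟩)⟩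
  have hG : G.Connected := by
    refine ⟨fun a b => ?_⟩
    induction hconn a b with
    | refl => exact SimpleGraph.Reachable.refl _
    | tail _ h ih =>
      obtain ⟨e, he, h1, h2⟩ := h
      exact ih.trans ((hadj e he _ h1).symm.trans (hadj e he _ h2))
  have h1 := hG.card_vert_le_card_edgeSet_add_one
  have h2 : Nat.card G.edgeSet ≤ S.card := by
    have hsub : G.edgeSet ⊆ (S : Set (Sym2 (Fin N))) := by
      rw [SimpleGraph.edgeSet_fromEdgeSet]
      exact Set.sdiff_subset
    rw [Nat.card_coe_set_eq, ← Set.ncard_coe_finset]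
    exact Set.ncard_le_ncard hsub S.finite_toSet
  have h3 : S.card ≤ E.card * (q - 1) := by
    refine Finset.card_biUnion_le_card_mul _ _ _ fun e he => ?_
    refine Finset.card_image_le.trans ?_
    rcases e.eq_empty_or_nonempty with rfl | hne
    · simp
    · rw [Finset.card_erase_of_mem (hc e hne), hcard e he]
  rw [Nat.card_eq_fintype_card, Fintype.card_fin] at h1
  rw [mul_comm]
  omega

lemma IsMultiHG.isHypertree_support {q v : ℕ} (hq : 2 ≤ q) {r : Finset (Fin v) → ℕ}
    (hr : IsMultiHG q v 0 r) :
    IsHypertree q v (Finset.univ.filter fun e => r e ≠ 0) ∧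
      r = fun e => if e ∈ Finset.univ.filter (fun e => r e ≠ 0) then 2 else 0 := by
  obtain ⟨hcard, heven, hconn, hsum⟩ := hr
  set E : Finset (Finset (Fin v)) := Finset.univ.filter fun e => r e ≠ 0 with hE
  have hcardE : ∀ e ∈ E, e.card = q := fun e he => hcard e (Finset.mem_filter.1 he).2
  have hconnE : HGConnected E := fun a b =>
    Relation.ReflTransGen.mono
      (fun x y ⟨e, he, hx, hy⟩ => ⟨e, by simpa [hE] using he, hx, hy⟩) a b (hconn a b)
  have h1 := le_mul_card_add_one hcardE hconnE
  have hS : ∑ e, r e = ∑ e ∈ E, r e := (Finset.sum_filter_ne_zero _).symm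
  have hge : ∀ e ∈ E, 2 ≤ r e := by
    intro e he
    have h0 := (Finset.mem_filter.1 he).2
    obtain ⟨t, ht⟩ := heven e
    omega
  have h2 : ∑ e ∈ E, 2 ≤ ∑ e ∈ E, r e := Finset.sum_le_sum hge
  have h2' : E.card * 2 ≤ ∑ e ∈ E, r e := by simpa using h2
  have h3 : (q - 1) * (E.card * 2) ≤ (q - 1) * ∑ e ∈ E, r e := Nat.mul_le_mul_left _ h2'
  rw [hS, add_zero] at hsum
  have h4 : (q - 1) * (E.card * 2) = (q - 1) * ∑ e ∈ E, r e := by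
    refine le_antisymm h3 ?_
    rw [hsum, ← mul_assoc]
    omega
  have h5 : ∑ e ∈ E, 2 = ∑ e ∈ E, r e := by
    rw [Finset.sum_const, smul_eq_mul]
    exact Nat.eq_of_mul_eq_mul_left (by omega) h4
  refine ⟨⟨hcardE, hconnE, ?_⟩, ?_⟩
  · rw [hsum, ← mul_assoc] at h4
    omega
  · have h6 := (Finset.sum_eq_sum_iff_of_le hge).1 h5
    ext e
    split_ifs with he
    · exact (h6 e he).symm
    · by_contra h0
      exact he (by simpa [hE] using h0)

lemma IsHypertree.isMultiHG {q v : ℕ} {E : Finset (Finset (Fin v))} (hE : IsHypertree q v E) :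
    IsMultiHG q v 0 fun e => if e ∈ E then 2 else 0 := by
  obtain ⟨hcard, hconn, hsize⟩ := hE
  refine ⟨fun e he => hcard e ?_, fun e => ?_,
    fun a b => Relation.ReflTransGen.mono ?_ a b (hconn a b), ?_⟩
  · by_contra h
    simp [h] at he
  · dsimp only
    split_ifs
    · exact even_two
    · exact Even.zero
  · rintro x y ⟨e, he, hx, hy⟩
    exact ⟨e, by simp [he], hx, hy⟩
  · dsimp only
    rw [Finset.sum_ite_mem, Finset.univ_inter, Finset.sum_const, smul_eq_mul, ← mul_assoc, hsize]
    omega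

end Counting

lemma rho_pow {q : ℕ} (hq2 : 2 ≤ q) (β : ℝ) (k : ℕ) :
    rho q β ^ ((q - 1) * k) = ((q - 1).factorial * β ^ 2 / 2 ^ (q + 1)) ^ k := by
  have hq1 : (q : ℝ) - 1 = ((q - 1 : ℕ) : ℝ) := by
    rw [Nat.cast_sub (by omega), Nat.cast_one]
  rw [pow_mul, rho, hq1, Real.rpow_inv_natCast_pow (by positivity) (by omega)]

lemma weight_pow {q n : ℕ} (hq : Even q) (hn : 0 < n) (β : ℝ) (k : ℕ) :
    (n : ℝ) ^ ((q - 1) * k) * (β * ((2 : ℝ) ^ (q / 2))⁻¹ * sigma q n) ^ (k + k) =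
      2 ^ k * ((q - 1).factorial * β ^ 2 / 2 ^ (q + 1)) ^ k := by
  have hσ : sigma q n ^ 2 = (q - 1).factorial / (n : ℝ) ^ (q - 1) :=
    Real.sq_sqrt (by positivity)
  have h2 : ((2 : ℝ) ^ (q / 2)) ^ 2 = 2 ^ q := by
    rw [← pow_mul, Nat.div_mul_cancel hq.two_dvd]
  have hn0 : (n : ℝ) ≠ 0 := by positivity
  rw [← two_mul, pow_mul, pow_mul, ← mul_pow, ← mul_pow, mul_pow _ (sigma q n), hσ, mul_pow β, inv_pow, h2]
  congr 1
  field_simp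
  ring

lemma IsHypertree.weight_mul_bMulti {q n v : ℕ} (hq : Even q) (hq2 : 2 ≤ q) (hn : 0 < n) (β : ℝ)
    {E : Finset (Finset (Fin v))} (hE : IsHypertree q v E) :
    (n : ℝ) ^ (v - 1) * ((β * ((2 : ℝ) ^ (q / 2))⁻¹ * sigma q n) ^ (E.card + E.card) *
      bMulti q (fun e => if e ∈ E then 2 else 0) (E.card + E.card) /
        (E.card + E.card).factorial) = rho q β ^ (v - 1) * bT E := by
  have hb := bMulti_eq hq E hE.1
  have hw := weight_pow hq hn β E.card
  have hf : ((E.card + E.card).factorial : ℝ) ≠ 0 := by positivity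
  rw [← hE.2.2, rho_pow hq2, ← mul_div_assoc, ← mul_assoc, hw, div_eq_iff hf]
  linear_combination ((q - 1).factorial * β ^ 2 / 2 ^ (q + 1)) ^ E.card * hb

lemma IsHypertree.two_lt {q v : ℕ} (hq2 : 2 ≤ q) {E : Finset (Finset (Fin v))}
    (hE : IsHypertree q v E) {e : Finset (Fin v)} (he : e ∈ E) : 2 < 2 * (v - 1 + 0) + 1 := by
  have h1 : 0 < (q - 1) * E.card := Nat.mul_pos (by omega) (Finset.card_pos.2 ⟨e, he⟩)
  have := hE.2.2
  omega

/-- For `1 ≤ v ≤ n`, `μ_{v,0} = μ_v`; in particular `μ_{v,0}` does not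
depend on `n`. -/
theorem muVD_zero_eq_mu (q n : ℕ) (hq : Even q) (hq2 : 2 ≤ q) (hn : q ≤ n)
    (β : ℝ) (v : ℕ) (hv1 : 1 ≤ v) (hvn : v ≤ n) :
    muVD q n β v 0 = mu q β v := by
  have hn0 : 0 < n := by omega
  rw [muVD, mu, div_mul_eq_mul_div, div_mul_eq_mul_div, Finset.mul_sum, Finset.mul_sum]
  congr 1
  simp only [mul_ite, mul_zero]
  rw [← Finset.sum_filter]
  refine Finset.sum_bij (fun r _ => Finset.univ.filter fun e => (r e : ℕ) ≠ 0) ?_ ?_ ?_ ?_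
  · intro r hr
    exact Finset.mem_filter.2 ⟨Finset.mem_univ _,
      ((Finset.mem_filter.1 hr).2.isHypertree_support hq2).1⟩
  · intro r hr s hs hrs
    have h1 := ((Finset.mem_filter.1 hr).2.isHypertree_support hq2).2
    have h2 := ((Finset.mem_filter.1 hs).2.isHypertree_support hq2).2
    rw [hrs, ← h2] at h1
    exact funext fun e => Fin.ext (congrFun h1 e)
  · intro E hE
    have hE' : IsHypertree q v E := (Finset.mem_filter.1 hE).2
    let r : Finset (Fin v) → Fin (2 * (v - 1 + 0) + 1) := fun e =>
      if he : e ∈ E then ⟨2, hE'.two_lt hq2 he⟩ else 0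
    have hr : (fun e => (r e : ℕ)) = fun e => if e ∈ E then 2 else 0 := by
      funext e
      simp only [r]
      split_ifs <;> rfl
    refine ⟨r, Finset.mem_filter.2 ⟨Finset.mem_univ _, ?_⟩, ?_⟩
    · rw [hr]
      exact hE'.isMultiHG
    · ext e
      have := congrFun hr e
      rw [Finset.mem_filter, this]
      simp
  · intro r hr
    obtain ⟨hE, hrE⟩ := (Finset.mem_filter.1 hr).2.isHypertree_support hq2
    set E : Finset (Finset (Fin v)) := Finset.univ.filter fun e => (r e : ℕ) ≠ 0
    have hsum : ∑ e, (r e : ℕ) = E.card + E.card := by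
      rw [Finset.sum_congr rfl fun e _ => congrFun hrE e, Finset.sum_ite_mem, Finset.univ_inter,
        Finset.sum_const, smul_eq_mul]
      omega
    rw [hsum, hrE]
    exact hE.weight_mul_bMulti hq hq2 hn0 β

end SYK
end
end

section
/- For every integer q ≥ 2 and every integer v ≥ 1 such that q−1 divides v−1, the number of q-uniform hypertrees on the labeled vertex set {1,…,v} equals (v−1)! · v^{s−1} / (s! · ((q−1)!)^s), where s = (v−1)/(q−1). -/
open MeasureTheory Filter

noncomputable section

namespace SYK

attribute [local instance] Classical.propDecidable

/-- The vertex `b` lies in the component of some element of `R`. -/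
def Reaches {N : ℕ} (E : Finset (Finset (Fin N))) (R : Finset (Fin N)) (b : Fin N) : Prop :=
  ∃ r ∈ R, Relation.ReflTransGen (edgeRel E) r b

section Reaches

variable {N : ℕ} {E E' : Finset (Finset (Fin N))} {R R' S e : Finset (Fin N)} {a b x y : Fin N}

lemma edgeRel_symm (h : edgeRel E a b) : edgeRel E b a := by
  obtain ⟨e, he, ha, hb⟩ := h
  exact ⟨e, he, hb, ha⟩

lemma reflTransGen_edgeRel_symm (h : Relation.ReflTransGen (edgeRel E) a b) :
    Relation.ReflTransGen (edgeRel E) b a :=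
  have : Std.Symm (edgeRel E) := ⟨fun _ _ => edgeRel_symm⟩
  Std.Symm.symm _ _ h

lemma Reaches.of_mem (h : x ∈ R) : Reaches E R x := ⟨x, h, .refl⟩

lemma Reaches.step (h : Reaches E R a) (hab : edgeRel E a b) : Reaches E R b := by
  obtain ⟨r, hr, h⟩ := h
  exact ⟨r, hr, h.tail hab⟩

lemma Reaches.mono (hE : E ⊆ E') (h : Reaches E R b) : Reaches E' R b := by
  obtain ⟨r, hr, h⟩ := h
  refine ⟨r, hr, Relation.ReflTransGen.mono ?_ _ _ h⟩
  rintro a b ⟨e, he, hab⟩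
  exact ⟨e, hE he, hab⟩

lemma Reaches.trans (h : Reaches E R b) (hR : ∀ r ∈ R, Reaches E R' r) : Reaches E R' b := by
  obtain ⟨r, hr, h⟩ := h
  obtain ⟨t, ht, h'⟩ := hR r hr
  exact ⟨t, ht, h'.trans h⟩

lemma Reaches.mono_right (hR : R ⊆ R') (h : Reaches E R b) : Reaches E R' b :=
  h.trans fun _ hr => .of_mem (hR hr)

/-- If `R` meets every component of `insert e E`, then some vertex of `e` is already joined to `R`
by `E`. -/
lemma exists_mem_reaches (he : e.Nonempty) (h : ∀ b, Reaches (insert e E) R b) :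
    ∃ x ∈ e, Reaches E R x := by
  by_contra! hx
  have key : ∀ b, Reaches (insert e E) R b → Reaches E R b := by
    rintro b ⟨r, hr, hb⟩
    induction hb with
    | refl => exact .of_mem hr
    | tail _ hbc ih =>
      obtain ⟨f, hf, hb, hc⟩ := hbc
      rcases Finset.mem_insert.1 hf with rfl | hf
      · exact absurd ih (hx _ hb)
      · exact ih.step ⟨f, hf, hb, hc⟩
  obtain ⟨y, hy⟩ := he
  exact hx y hy (key y (h y))

lemma reaches_union_erase (hx : Reaches E R x) (h : ∀ b, Reaches (insert e E) R b) (b : Fin N) :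
    Reaches E (R ∪ e.erase x) b := by
  obtain ⟨r, hr, hb⟩ := h b
  induction hb with
  | refl => exact .of_mem (Finset.mem_union_left _ hr)
  | @tail b c _ hbc ih =>
    obtain ⟨f, hf, hb, hc⟩ := hbc
    rcases Finset.mem_insert.1 hf with rfl | hf
    · by_cases hcx : c = x
      · subst hcx
        exact hx.mono_right Finset.subset_union_left
      · exact .of_mem (Finset.mem_union_right _ (Finset.mem_erase.2 ⟨hcx, hc⟩))
    · exact ih.step ⟨f, hf, hb, hc⟩

/-- A `q`-uniform hypergraph with `s` hyperedges on `N` vertices has at least `N - (q - 1) s`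
components. -/
lemma le_card_add_of_reaches {q : ℕ} (hq : 1 ≤ q) (hE : ∀ e ∈ E, e.card = q)
    (h : ∀ b, Reaches E R b) : N ≤ R.card + (q - 1) * E.card := by
  induction E using Finset.induction_on generalizing R with
  | empty =>
    have hR : R = Finset.univ := by
      refine Finset.eq_univ_iff_forall.2 fun b => ?_
      obtain ⟨r, hr, hb⟩ := h b
      cases hb with
      | refl => exact hr
      | tail _ hbc => obtain ⟨f, hf, -⟩ := hbc; simp at hf
    simp [hR]
  | insert e E heE ih =>
    have hecard : e.card = q := hE e (Finset.mem_insert_self _ _)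
    obtain ⟨x, hxe, hx⟩ := exists_mem_reaches (Finset.card_pos.1 (by omega)) h
    have h1 := ih (fun f hf => hE f (Finset.mem_insert_of_mem hf)) (reaches_union_erase hx h)
    have h2 := Finset.card_union_le R (e.erase x)
    rw [Finset.card_erase_of_mem hxe, hecard] at h2
    rw [Finset.card_insert_of_notMem heE, mul_add]
    omega

end Reaches

/-- Rooted `q`-uniform hyperforests with `i` hyperedges: `R` is the set of roots, one in each
component. -/
def rootedForests (q N i : ℕ) : Finset (Finset (Finset (Fin N)) × Finset (Fin N)) :=
  Finset.univ.filter fun p => (∀ e ∈ p.1, e.card = q) ∧ p.1.card = i ∧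
    p.2.card + (q - 1) * i = N ∧ ∀ b, Reaches p.1 p.2 b

section rootedForests

variable {q N i : ℕ} {E : Finset (Finset (Fin N))} {R S : Finset (Fin N)} {r r' x : Fin N}

lemma mem_rootedForests : (E, R) ∈ rootedForests q N i ↔ (∀ e ∈ E, e.card = q) ∧ E.card = i ∧
    R.card + (q - 1) * i = N ∧ ∀ b, Reaches E R b := by
  simp [rootedForests]

lemma not_reaches_erase_root (hq : 1 ≤ q) (h : (E, R) ∈ rootedForests q N i) (hr : r ∈ R) :
    ¬ Reaches E (R.erase r) r := by
  intro hreach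
  obtain ⟨hE, hi, hc, hR⟩ := mem_rootedForests.1 h
  have h1 : N ≤ (R.erase r).card + (q - 1) * E.card := by
    refine le_card_add_of_reaches hq hE fun b => (hR b).trans fun t ht => ?_
    by_cases htr : t = r
    · exact htr ▸ hreach
    · exact .of_mem (Finset.mem_erase.2 ⟨htr, ht⟩)
  have h2 := Finset.card_erase_lt_of_mem hr
  rw [hi] at h1
  omega

lemma not_reaches_sdiff_root (hq : 1 ≤ q) (h : (E, R) ∈ rootedForests q N i) (hS : S ⊆ R)
    (hr : r ∈ S) : ¬ Reaches E (R \ S) r := fun hreach =>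
  not_reaches_erase_root hq h (hS hr) <| hreach.mono_right fun t ht => by
    rw [Finset.mem_sdiff] at ht
    exact Finset.mem_erase.2 ⟨fun hh => ht.2 (hh ▸ hr), ht.1⟩

lemma root_unique (hq : 1 ≤ q) (h : (E, R) ∈ rootedForests q N i) (hr : r ∈ R) (hr' : r' ∈ R)
    (hx : Relation.ReflTransGen (edgeRel E) r x) (hx' : Relation.ReflTransGen (edgeRel E) r' x) :
    r = r' := by
  by_contra hne
  exact not_reaches_erase_root hq h hr'
    ⟨r, Finset.mem_erase.2 ⟨hne, hr⟩, hx.trans (reflTransGen_edgeRel_symm hx')⟩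

/-- The sets of `q - 1` roots which can be attached below the vertex `x`. -/
def attachable (q : ℕ) (E : Finset (Finset (Fin N))) (R : Finset (Fin N)) (x : Fin N) :
    Finset (Finset (Fin N)) :=
  (R.powersetCard (q - 1)).filter fun S => Reaches E (R \ S) x

lemma mem_attachable :
    S ∈ attachable q E R x ↔ (S ⊆ R ∧ S.card = q - 1) ∧ Reaches E (R \ S) x := by
  simp [attachable, Finset.mem_powersetCard]

lemma card_attachable (hq : 1 ≤ q) (h : (E, R) ∈ rootedForests q N i) (x : Fin N) :
    (attachable q E R x).card = (N - 1 - (q - 1) * i).choose (q - 1) := by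
  obtain ⟨hE, hi, hc, hR⟩ := mem_rootedForests.1 h
  obtain ⟨r, hr, hrx⟩ := hR x
  have heq : attachable q E R x = (R.erase r).powersetCard (q - 1) := by
    ext S
    rw [mem_attachable, Finset.mem_powersetCard, Finset.subset_erase]
    constructor
    · rintro ⟨⟨hS, hcard⟩, t, ht, htx⟩
      rw [Finset.mem_sdiff] at ht
      rw [root_unique hq h ht.1 hr htx hrx] at ht
      exact ⟨⟨hS, ht.2⟩, hcard⟩
    · rintro ⟨⟨hS, hrS⟩, hcard⟩
      exact ⟨⟨hS, hcard⟩, r, Finset.mem_sdiff.2 ⟨hr, hrS⟩, hrx⟩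
  rw [heq, Finset.card_powersetCard, Finset.card_erase_of_mem hr]
  congr 1
  omega

lemma notMem_of_attachable (hq : 1 ≤ q) (h : (E, R) ∈ rootedForests q N i)
    (hS : S ∈ attachable q E R x) : x ∉ S := fun hxS => by
  obtain ⟨⟨hSR, -⟩, hx⟩ := mem_attachable.1 hS
  exact not_reaches_sdiff_root hq h hSR hxS hx

lemma insert_notMem_of_attachable (hq : 2 ≤ q) (h : (E, R) ∈ rootedForests q N i)
    (hS : S ∈ attachable q E R x) : insert x S ∉ E := fun hmem => by
  obtain ⟨⟨hSR, hcard⟩, hx⟩ := mem_attachable.1 hS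
  obtain ⟨t, ht⟩ : S.Nonempty := Finset.card_pos.1 (by omega)
  exact not_reaches_sdiff_root (by omega) h hSR ht
    (hx.step ⟨_, hmem, Finset.mem_insert_self _ _, Finset.mem_insert_of_mem ht⟩)

lemma attach_mem_rootedForests (hq : 2 ≤ q) (h : (E, R) ∈ rootedForests q N i)
    (hS : S ∈ attachable q E R x) :
    (insert (insert x S) E, R \ S) ∈ rootedForests q N (i + 1) := by
  have hxS := notMem_of_attachable (by omega) h hS
  have hnot := insert_notMem_of_attachable hq h hS
  obtain ⟨⟨hSR, hcard⟩, hx⟩ := mem_attachable.1 hS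
  obtain ⟨hE, hi, hc, hR⟩ := mem_rootedForests.1 h
  refine mem_rootedForests.2 ⟨?_, ?_, ?_, fun b => ?_⟩
  · intro e he
    rcases Finset.mem_insert.1 he with rfl | he
    · rw [Finset.card_insert_of_notMem hxS]
      omega
    · exact hE e he
  · rw [Finset.card_insert_of_notMem hnot, hi]
  · have h1 := Finset.card_sdiff_add_card_eq_card hSR
    rw [mul_add]
    omega
  · refine ((hR b).mono (Finset.subset_insert _ _)).trans fun t ht => ?_
    by_cases htS : t ∈ S
    · exact (hx.mono (Finset.subset_insert _ _)).step
        ⟨_, Finset.mem_insert_self _ _, Finset.mem_insert_self _ _, Finset.mem_insert_of_mem htS⟩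
    · exact .of_mem (Finset.mem_sdiff.2 ⟨ht, htS⟩)

/-- Every hyperedge of a rooted hyperforest arises by attaching roots below a vertex. -/
lemma exists_detach (hq : 2 ≤ q) {e : Finset (Fin N)}
    (h : (E, R) ∈ rootedForests q N (i + 1)) (he : e ∈ E) :
    ∃ x ∈ e, (E.erase e, R ∪ e.erase x) ∈ rootedForests q N i ∧ Disjoint R (e.erase x) ∧
      e.erase x ∈ attachable q (E.erase e) (R ∪ e.erase x) x := by
  obtain ⟨hE, hi, hc, hR⟩ := mem_rootedForests.1 h
  have hecard := hE e he
  rw [← Finset.insert_erase he] at hR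
  obtain ⟨x, hxe, hx⟩ := exists_mem_reaches (Finset.card_pos.1 (by omega)) hR
  have hspan := reaches_union_erase hx hR
  have hE' : ∀ f ∈ E.erase e, f.card = q := fun f hf => hE f (Finset.mem_of_mem_erase hf)
  have hi' : (E.erase e).card = i := by
    rw [Finset.card_erase_of_mem he]
    omega
  have h1 := le_card_add_of_reaches (by omega) hE' hspan
  have h2 := Finset.card_union_add_card_inter R (e.erase x)
  have h3 := Finset.card_erase_of_mem hxe
  rw [hi'] at h1
  rw [mul_add] at hc
  have hdisj : Disjoint R (e.erase x) := by
    rw [Finset.disjoint_iff_inter_eq_empty, ← Finset.card_eq_zero]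
    omega
  refine ⟨x, hxe, mem_rootedForests.2 ⟨hE', hi', by omega, hspan⟩, hdisj, mem_attachable.2
    ⟨⟨Finset.subset_union_right, by omega⟩, ?_⟩⟩
  rwa [Finset.union_sdiff_cancel_right hdisj]

lemma succ_mul_card_rootedForests (hq : 2 ≤ q) :
    (i + 1) * (rootedForests q N (i + 1)).card =
      (rootedForests q N i).card * (N * (N - 1 - (q - 1) * i).choose (q - 1)) := by
  have hP : ((rootedForests q N i).sigma fun p =>
      (Finset.univ : Finset (Fin N)).sigma fun x => attachable q p.1 p.2 x).card =
      (rootedForests q N i).card * (N * (N - 1 - (q - 1) * i).choose (q - 1)) := by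
    rw [Finset.card_sigma, Finset.sum_const_nat]
    rintro ⟨E, R⟩ h
    rw [Finset.card_sigma, Finset.sum_const_nat fun x _ => card_attachable (by omega) h x,
      Finset.card_univ, Fintype.card_fin]
  have hQ : ((rootedForests q N (i + 1)).sigma fun p => p.1).card =
      (rootedForests q N (i + 1)).card * (i + 1) := by
    rw [Finset.card_sigma, Finset.sum_const_nat]
    rintro ⟨E, R⟩ h
    exact (mem_rootedForests.1 h).2.1
  rw [← hP, mul_comm, ← hQ]
  symm
  refine Finset.card_bij
    (fun p _ => ⟨(insert (insert p.2.1 p.2.2) p.1.1, p.1.2 \ p.2.2), insert p.2.1 p.2.2⟩) ?_ ?_ ?_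
  · rintro ⟨⟨E, R⟩, x, S⟩ h
    simp only [Finset.mem_sigma, Finset.mem_univ, true_and] at h ⊢
    exact ⟨attach_mem_rootedForests hq h.1 h.2, Finset.mem_insert_self _ _⟩
  · rintro ⟨⟨E, R⟩, x, S⟩ h ⟨⟨E', R'⟩, x', S'⟩ h' heq
    simp only [Finset.mem_sigma, Finset.mem_univ, true_and] at h h'
    simp only [Sigma.mk.injEq, Prod.mk.injEq, heq_eq_eq] at heq
    obtain ⟨⟨hEE, hRR⟩, hee⟩ := heq
    have hE : E = E' := by
      rw [← Finset.erase_insert (insert_notMem_of_attachable hq h.1 h.2),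
        ← Finset.erase_insert (insert_notMem_of_attachable hq h'.1 h'.2), hEE, hee]
    subst hE
    have hx : x = x' := by
      by_contra hne
      have hx'S : x' ∈ S := by
        have : x' ∈ insert x S := hee ▸ Finset.mem_insert_self _ _
        exact (Finset.mem_insert.1 this).resolve_left (Ne.symm hne)
      refine not_reaches_sdiff_root (by omega) h.1 (mem_attachable.1 h.2).1.1 hx'S ?_
      rw [hRR]
      exact (mem_attachable.1 h'.2).2
    subst hx
    have hS : S = S' := by
      rw [← Finset.erase_insert (notMem_of_attachable (by omega) h.1 h.2),
        ← Finset.erase_insert (notMem_of_attachable (by omega) h'.1 h'.2), hee]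
    subst hS
    have hR : R = R' := by
      rw [← Finset.sdiff_union_of_subset (mem_attachable.1 h.2).1.1, hRR,
        Finset.sdiff_union_of_subset (mem_attachable.1 h'.2).1.1]
    rw [hR]
  · rintro ⟨⟨E, R⟩, e⟩ h
    simp only [Finset.mem_sigma] at h
    obtain ⟨x, hxe, hF, hdisj, hS⟩ := exists_detach hq h.1 h.2
    refine ⟨⟨(E.erase e, R ∪ e.erase x), x, e.erase x⟩, ?_, ?_⟩
    · simp only [Finset.mem_sigma, Finset.mem_univ, true_and]
      exact ⟨hF, hS⟩
    · simp only [Finset.insert_erase hxe, Finset.insert_erase h.2,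
        Finset.union_sdiff_cancel_right hdisj]

lemma card_rootedForests_zero : (rootedForests q N 0).card = 1 := by
  rw [Finset.card_eq_one]
  refine ⟨(∅, Finset.univ), Finset.ext ?_⟩
  rintro ⟨E, R⟩
  rw [mem_rootedForests, Finset.mem_singleton, Prod.mk.injEq]
  constructor
  · rintro ⟨-, hE, hR, -⟩
    refine ⟨Finset.card_eq_zero.1 hE, (Finset.card_eq_iff_eq_univ R).1 ?_⟩
    simpa using hR
  · rintro ⟨rfl, rfl⟩
    simp [Reaches.of_mem]

lemma card_rootedForests (hq : 2 ≤ q) (hi : (q - 1) * i ≤ N - 1) :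
    i.factorial * (q - 1).factorial ^ i * (rootedForests q N i).card *
      (N - 1 - (q - 1) * i).factorial = N ^ i * (N - 1).factorial := by
  induction i with
  | zero => simp [card_rootedForests_zero]
  | succ i ih =>
    rw [mul_add, mul_one] at hi
    have hchoose := Nat.choose_mul_factorial_mul_factorial
      (show q - 1 ≤ N - 1 - (q - 1) * i by omega)
    have hrec := succ_mul_card_rootedForests (q := q) (N := N) (i := i) hq
    have hsub : N - 1 - (q - 1) * (i + 1) = N - 1 - (q - 1) * i - (q - 1) := by
      rw [mul_add, mul_one]
      omega
    have ih := ih (by omega)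
    rw [← hchoose] at ih
    rw [hsub, Nat.factorial_succ, pow_succ N, mul_right_comm (N ^ i), ← ih]
    linear_combination (i.factorial * (q - 1).factorial ^ (i + 1) *
      (N - 1 - (q - 1) * i - (q - 1)).factorial) * hrec

/-- Rooted hyperforests with a single root are hypertrees with a distinguished vertex. -/
lemma card_rootedForests_eq_mul_trees (hN : (q - 1) * i + 1 = N) (hq : 2 ≤ q) :
    (rootedForests q N i).card = (trees q N).card * N := by
  have hprod : ((trees q N) ×ˢ (Finset.univ : Finset (Fin N))).card = (trees q N).card * N := by
    simp
  rw [← hprod]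
  symm
  refine Finset.card_bij (fun p _ => (p.1, {p.2})) ?_ ?_ ?_
  · rintro ⟨E, r⟩ h
    simp only [Finset.mem_product, trees, Finset.mem_filter, Finset.mem_univ, true_and,
      and_true] at h
    obtain ⟨hE, hconn, hcard⟩ := h
    refine mem_rootedForests.2 ⟨hE, ?_, ?_, fun b => ⟨r, Finset.mem_singleton_self r, hconn r b⟩⟩
    · exact Nat.eq_of_mul_eq_mul_left (show 0 < q - 1 by omega) (by dsimp only at hcard ⊢; omega)
    · rw [Finset.card_singleton]
      omega
  · rintro ⟨E, r⟩ - ⟨E', r'⟩ - h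
    simpa using h
  · rintro ⟨E, R⟩ h
    obtain ⟨hE, hi, hc, hR⟩ := mem_rootedForests.1 h
    obtain ⟨r, rfl⟩ := Finset.card_eq_one.1 (show R.card = 1 by omega)
    refine ⟨(E, r), ?_, rfl⟩
    have hr : ∀ b, Relation.ReflTransGen (edgeRel E) r b := fun b => by
      obtain ⟨t, ht, htb⟩ := hR b
      rwa [Finset.mem_singleton.1 ht] at htb
    simp only [Finset.mem_product, trees, Finset.mem_filter, Finset.mem_univ, true_and, and_true]
    refine ⟨hE, fun a b => (reflTransGen_edgeRel_symm (hr a)).trans (hr b), ?_⟩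
    rw [hi]
    omega

end rootedForests

/-- The number of `q`-uniform hypertrees on the labeled vertex set
`{1,…,v}` equals `(v−1)! v^{s−1} / (s! ((q−1)!)^s)` where `s = (v−1)/(q−1)`. -/
theorem card_trees (q : ℕ) (hq : 2 ≤ q) (v : ℕ) (hv : 1 ≤ v)
    (hdvd : (q - 1) ∣ (v - 1)) :
    ((trees q v).card : ℝ)
      = ((v - 1).factorial : ℝ) * (v : ℝ) ^ ((((v - 1) / (q - 1) : ℕ) : ℤ) - 1) /
          ((((v - 1) / (q - 1)).factorial : ℝ)
            * (((q - 1).factorial : ℝ)) ^ ((v - 1) / (q - 1))) := by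
  obtain ⟨s, hs⟩ := hdvd
  have hdiv : (v - 1) / (q - 1) = s := by
    rw [hs, Nat.mul_div_cancel_left _ (by omega)]
  have hcount := card_rootedForests (N := v) (i := s) hq hs.ge
  rw [card_rootedForests_eq_mul_trees (by omega) hq, ← hs, Nat.sub_self, Nat.factorial_zero,
    mul_one] at hcount
  have hcount' : (s.factorial : ℝ) * ((q - 1).factorial : ℝ) ^ s * ((trees q v).card * v) =
      (v : ℝ) ^ s * ((v - 1).factorial : ℝ) := by
    exact_mod_cast hcount
  have hv0 : (v : ℝ) ≠ 0 := by
    have : v ≠ 0 := by omega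
    exact_mod_cast this
  rw [hdiv, zpow_sub_one₀ hv0, zpow_natCast, eq_div_iff (by positivity)]
  field_simp
  linear_combination hcount'

end SYK
end
end
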